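/- Min-based equal-treatment preferences are type-II-monotonic: let G be a network of friends on N = {1,…,n}, let i ∈ N, let j ∈ E_i, let Γ, Δ be coalition structures on N with j ∈ Γ(i) \ Δ(i) and v_j(Γ) ≥ v_j(Δ), and let G' be the graph obtained from G by adding the edge {i,j}; write u' for the min-based equal-treatment utility in G'. Then u^minEQ_i(Γ) > u^minEQ_i(Δ) implies u'^minEQ_i(Γ) > u'^minEQ_i(Δ), and u^minEQ_i(Γ) = u^minEQ_i(Δ) implies u'^minEQ_i(Γ) ≥ u'^minEQ_i(Δ). -/

import Mathlib

namespace ACFG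

/-- A coalition structure on the player set `Fin n` (the players `1,…,n`), represented by
the map sending each player to her coalition (her block of the partition). -/
structure CoalitionStructure (n : ℕ) where
  block : Fin n → Finset (Fin n)
  mem_block : ∀ i, i ∈ block i
  block_eq : ∀ i j, j ∈ block i → block j = block i

variable {n : ℕ}

/-- The set `F_i` of friends of player `i` in the network of friends `G`. -/
def friends (G : SimpleGraph (Fin n)) [DecidableRel G.Adj] (i : Fin n) : Finset (Fin n) :=
  Finset.univ.filter (fun j => G.Adj i j)

/-- The set `E_i` of enemies of player `i`: all players other than `i` and her friends. -/
def enemies (G : SimpleGraph (Fin n)) [DecidableRel G.Adj] (i : Fin n) : Finset (Fin n) :=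
  (insert i (friends G i))ᶜ

/-- The friend-oriented value of player `i` for the coalition structure `Γ`:
`v_i(Γ) = n·|Γ(i) ∩ F_i| − |Γ(i) ∩ E_i|`. -/
def val (G : SimpleGraph (Fin n)) [DecidableRel G.Adj] (Γ : CoalitionStructure n)
    (i : Fin n) : ℤ :=
  (n : ℤ) * ((Γ.block i ∩ friends G i).card : ℤ) - ((Γ.block i ∩ enemies G i).card : ℤ)

/-- `sumF_i(Γ)`: the sum of the values of `i`'s friends. -/
def sumF (G : SimpleGraph (Fin n)) [DecidableRel G.Adj] (Γ : CoalitionStructure n)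
    (i : Fin n) : ℤ :=
  ∑ f ∈ friends G i, val G Γ f

/-- `sumF+_i(Γ)`: the sum of the values of `i`'s friends and of `i` herself. -/
def sumFplus (G : SimpleGraph (Fin n)) [DecidableRel G.Adj] (Γ : CoalitionStructure n)
    (i : Fin n) : ℤ :=
  ∑ f ∈ insert i (friends G i), val G Γ f

/-- `minF_i(Γ)`: the minimum of the values of `i`'s friends (`0` if `i` has no friends). -/
def minF (G : SimpleGraph (Fin n)) [DecidableRel G.Adj] (Γ : CoalitionStructure n)
    (i : Fin n) : ℤ :=
  if h : (friends G i).Nonempty then (friends G i).inf' h (val G Γ) else 0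

/-- `minF+_i(Γ)`: the minimum of the values of `i`'s friends and of `i` herself. -/
def minFplus (G : SimpleGraph (Fin n)) [DecidableRel G.Adj] (Γ : CoalitionStructure n)
    (i : Fin n) : ℤ :=
  (insert i (friends G i)).inf' (Finset.insert_nonempty _ _) (val G Γ)

/-- Sum-based selfish-first utility: `u^sumSF_i(Γ) = M·v_i(Γ) + sumF_i(Γ)`. -/
def usumSF (G : SimpleGraph (Fin n)) [DecidableRel G.Adj] (M : ℤ) (Γ : CoalitionStructure n)
    (i : Fin n) : ℤ :=
  M * val G Γ i + sumF G Γ i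

/-- Sum-based equal-treatment utility: `u^sumEQ_i(Γ) = sumF+_i(Γ)`. -/
def usumEQ (G : SimpleGraph (Fin n)) [DecidableRel G.Adj] (Γ : CoalitionStructure n)
    (i : Fin n) : ℤ :=
  sumFplus G Γ i

/-- Sum-based altruistic-treatment utility: `u^sumAL_i(Γ) = v_i(Γ) + M·sumF_i(Γ)`. -/
def usumAL (G : SimpleGraph (Fin n)) [DecidableRel G.Adj] (M : ℤ) (Γ : CoalitionStructure n)
    (i : Fin n) : ℤ :=
  val G Γ i + M * sumF G Γ i

/-- Min-based selfish-first utility: `u^minSF_i(Γ) = M·v_i(Γ) + minF_i(Γ)`. -/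
def uminSF (G : SimpleGraph (Fin n)) [DecidableRel G.Adj] (M : ℤ) (Γ : CoalitionStructure n)
    (i : Fin n) : ℤ :=
  M * val G Γ i + minF G Γ i

/-- Min-based equal-treatment utility: `u^minEQ_i(Γ) = minF+_i(Γ)`. -/
def uminEQ (G : SimpleGraph (Fin n)) [DecidableRel G.Adj] (Γ : CoalitionStructure n)
    (i : Fin n) : ℤ :=
  minFplus G Γ i

/-- Min-based altruistic-treatment utility: `u^minAL_i(Γ) = v_i(Γ) + M·minF_i(Γ)`. -/
def uminAL (G : SimpleGraph (Fin n)) [DecidableRel G.Adj] (M : ℤ) (Γ : CoalitionStructure n)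
    (i : Fin n) : ℤ :=
  val G Γ i + M * minF G Γ i

/-- The graph `G'` obtained from `G` by adding the edge `{i, j}`. -/
def addEdge (G : SimpleGraph (Fin n)) (i j : Fin n) : SimpleGraph (Fin n) :=
  G ⊔ SimpleGraph.fromEdgeSet {s(i, j)}

instance (G : SimpleGraph (Fin n)) [DecidableRel G.Adj] (i j : Fin n) :
    DecidableRel (addEdge G i j).Adj := fun a b =>
  decidable_of_iff (G.Adj a b ∨ (s(a, b) = s(i, j) ∧ a ≠ b)) (by
    simp [addEdge, SimpleGraph.fromEdgeSet_adj])

theorem val_congr {G H : SimpleGraph (Fin n)} [DecidableRel G.Adj] [DecidableRel H.Adj]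
    {a : Fin n} (h : friends H a = friends G a) (Γ : CoalitionStructure n) :
    val H Γ a = val G Γ a := by
  simp only [val, enemies, h]

theorem val_of_friends_eq_insert {G H : SimpleGraph (Fin n)} [DecidableRel G.Adj]
    [DecidableRel H.Adj] {a b : Fin n} (hb : b ∈ enemies G a)
    (h : friends H a = insert b (friends G a)) (Γ : CoalitionStructure n) :
    val H Γ a = val G Γ a + if b ∈ Γ.block a then (n : ℤ) + 1 else 0 := by
  have he : enemies H a = (enemies G a).erase b := by
    ext x
    simp only [enemies, h, Finset.mem_compl, Finset.mem_insert, Finset.mem_erase]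
    tauto
  have hbf : b ∉ friends G a := by
    simp only [enemies, Finset.mem_compl, Finset.mem_insert] at hb
    tauto
  simp only [val, h, he]
  split_ifs with hmem
  · rw [Finset.inter_insert_of_mem hmem, Finset.card_insert_of_notMem (by simp [hbf]),
      Finset.inter_erase]
    have := Finset.card_erase_add_one (Finset.mem_inter.2 ⟨hmem, hb⟩)
    rw [← this]
    push_cast
    ring
  · rw [Finset.inter_insert_of_notMem hmem, Finset.inter_erase,
      Finset.erase_eq_of_notMem (by simp [hmem])]
    ring

theorem addEdge_adj (G : SimpleGraph (Fin n)) (i j a b : Fin n) :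
    (addEdge G i j).Adj a b ↔ G.Adj a b ∨ (s(a, b) = s(i, j) ∧ a ≠ b) := by
  simp [addEdge, SimpleGraph.fromEdgeSet_adj]

theorem friends_addEdge_left (G : SimpleGraph (Fin n)) [DecidableRel G.Adj] {i j : Fin n}
    (hij : i ≠ j) : friends (addEdge G i j) i = insert j (friends G i) := by
  ext x
  simp only [friends, addEdge_adj, Finset.mem_filter, Finset.mem_univ, true_and,
    Finset.mem_insert, Sym2.eq_iff]
  grind

theorem friends_addEdge_right (G : SimpleGraph (Fin n)) [DecidableRel G.Adj] {i j : Fin n}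
    (hij : i ≠ j) : friends (addEdge G i j) j = insert i (friends G j) := by
  ext x
  simp only [friends, addEdge_adj, Finset.mem_filter, Finset.mem_univ, true_and,
    Finset.mem_insert, Sym2.eq_iff]
  grind

theorem friends_addEdge_of_ne (G : SimpleGraph (Fin n)) [DecidableRel G.Adj] {i j k : Fin n}
    (hki : k ≠ i) (hkj : k ≠ j) : friends (addEdge G i j) k = friends G k := by
  ext x
  simp only [friends, addEdge_adj, Finset.mem_filter, Finset.mem_univ, true_and,
    Sym2.eq_iff]
  grind

theorem mem_enemies (G : SimpleGraph (Fin n)) [DecidableRel G.Adj] {i j : Fin n} :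
    j ∈ enemies G i ↔ i ≠ j ∧ ¬ G.Adj i j := by
  simp [enemies, friends, eq_comm]

theorem mem_enemies_comm (G : SimpleGraph (Fin n)) [DecidableRel G.Adj] {i j : Fin n} :
    j ∈ enemies G i ↔ i ∈ enemies G j := by
  rw [mem_enemies, mem_enemies, ne_comm, G.adj_comm]

theorem CoalitionStructure.mem_block_comm (Γ : CoalitionStructure n) {i j : Fin n} :
    j ∈ Γ.block i ↔ i ∈ Γ.block j :=
  ⟨fun h => Γ.block_eq i j h ▸ Γ.mem_block i, fun h => Γ.block_eq j i h ▸ Γ.mem_block j⟩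

theorem val_le_val_addEdge (G : SimpleGraph (Fin n)) [DecidableRel G.Adj] {i j : Fin n}
    (hj : j ∈ enemies G i) (Γ : CoalitionStructure n) (k : Fin n) :
    val G Γ k ≤ val (addEdge G i j) Γ k := by
  have hij := ((mem_enemies G).1 hj).1
  by_cases hki : k = i
  · subst hki
    rw [val_of_friends_eq_insert hj (friends_addEdge_left G hij)]
    split_ifs <;> lia
  by_cases hkj : k = j
  · subst hkj
    rw [val_of_friends_eq_insert ((mem_enemies_comm G).1 hj) (friends_addEdge_right G hij)]
    split_ifs <;> lia
  exact (val_congr (friends_addEdge_of_ne G hki hkj) Γ).ge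

theorem val_addEdge_of_notMem (G : SimpleGraph (Fin n)) [DecidableRel G.Adj] {i j : Fin n}
    (hj : j ∈ enemies G i) {Γ : CoalitionStructure n} (h : j ∉ Γ.block i) :
    val (addEdge G i j) Γ = val G Γ := by
  have hij := ((mem_enemies G).1 hj).1
  ext k
  by_cases hki : k = i
  · subst hki
    rw [val_of_friends_eq_insert hj (friends_addEdge_left G hij), if_neg h, add_zero]
  by_cases hkj : k = j
  · subst hkj
    rw [val_of_friends_eq_insert ((mem_enemies_comm G).1 hj) (friends_addEdge_right G hij),
      if_neg (mt Γ.mem_block_comm.2 h), add_zero]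
  exact val_congr (friends_addEdge_of_ne G hki hkj) Γ

theorem val_lt_val_addEdge_right (G : SimpleGraph (Fin n)) [DecidableRel G.Adj] {i j : Fin n}
    (hj : j ∈ enemies G i) {Γ : CoalitionStructure n} (h : j ∈ Γ.block i) :
    val G Γ j < val (addEdge G i j) Γ j := by
  have hij := ((mem_enemies G).1 hj).1
  rw [val_of_friends_eq_insert ((mem_enemies_comm G).1 hj) (friends_addEdge_right G hij),
    if_pos (Γ.mem_block_comm.1 h)]
  lia

theorem uminEQ_addEdge (G : SimpleGraph (Fin n)) [DecidableRel G.Adj] {i j : Fin n}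
    (hij : i ≠ j) (Γ : CoalitionStructure n) :
    uminEQ (addEdge G i j) Γ i =
      val (addEdge G i j) Γ j ⊓
        (insert i (friends G i)).inf' (Finset.insert_nonempty _ _)
          (val (addEdge G i j) Γ) := by
  simp only [uminEQ, minFplus, friends_addEdge_left G hij, Finset.insert_comm i j]
  exact Finset.inf'_insert _ _

/-- Min-based equal-treatment preferences are type-II-monotonic: if
the enemy `j` of `i` satisfies `j ∈ Γ(i) \ Δ(i)` and `v_j(Γ) ≥ v_j(Δ)`, then turning `j`
into a friend of `i` preserves `i`'s strict preference of `Γ` over `Δ`, and turns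
indifference into weak preference. -/
theorem minEQ_typeII_monotonic (G : SimpleGraph (Fin n)) [DecidableRel G.Adj]
    (i j : Fin n) (hj : j ∈ enemies G i)
    (Γ Δ : CoalitionStructure n) (hv : val G Δ j ≤ val G Γ j)
    (hcase : j ∈ Γ.block i ∧ j ∉ Δ.block i) :
    (uminEQ G Δ i < uminEQ G Γ i →
        uminEQ (addEdge G i j) Δ i < uminEQ (addEdge G i j) Γ i) ∧
      (uminEQ G Γ i = uminEQ G Δ i →
        uminEQ (addEdge G i j) Δ i ≤ uminEQ (addEdge G i j) Γ i) := by
  have hij := ((mem_enemies G).1 hj).1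
  have hΓ : uminEQ G Γ i ≤ (insert i (friends G i)).inf' (Finset.insert_nonempty _ _)
      (val (addEdge G i j) Γ) :=
    Finset.inf'_mono_fun fun k _ => val_le_val_addEdge G hj Γ k
  have hjΓ := val_lt_val_addEdge_right G hj hcase.1
  have hΔ : uminEQ (addEdge G i j) Δ i = val G Δ j ⊓ uminEQ G Δ i := by
    rw [uminEQ_addEdge G hij, val_addEdge_of_notMem G hj hcase.2]
    rfl
  rw [hΔ, uminEQ_addEdge G hij Γ]
  refine ⟨fun h => lt_inf_iff.2 ⟨?_, ?_⟩, fun h => le_inf ?_ ?_⟩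
  · exact inf_le_left.trans_lt (hv.trans_lt hjΓ)
  · exact inf_le_right.trans_lt (h.trans_le hΓ)
  · exact inf_le_left.trans (hv.trans hjΓ.le)
  · exact inf_le_right.trans (h.ge.trans hΓ)

end ACFG
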